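/- Let α ∈ {−1/d : d ∈ ℕ, d ≥ 2} ∪ [0,∞). There exists a constant c_α > 0, depending only on α, such that for every q ∈ [0,1] and every very simple increasing color-difference process (Δ(n))_{n≥1} with parameters (α, q) on a probability space (Ω, 𝒜, μ): limsup_{N→∞} [ μ(Δ₁(N) < 0) + (1/2)·μ(Δ₁(N) = 0) ] ≤ c_α·√q. -/

import Mathlib

open MeasureTheory Filter
open scoped ENat


/-- Normalisation `Z_α(n) = α(1 - 1/n) + 1` for very simple increasing trees. -/
noncomputable def Zvs (α : ℝ) (n : ℕ) : ℝ := α * (1 - 1 / (n : ℝ)) + 1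

/-- `p(n, x₁, x₂) = (1/2)(1 + (x₁ + α x₂)/(Z_α(n) n))`, the probability that the new vertex
attaches to a red vertex. -/
noncomputable def pvs (α : ℝ) (n : ℕ) (x₁ x₂ : ℤ) : ℝ :=
  (1 / 2) * (1 + ((x₁ : ℝ) + α * (x₂ : ℝ)) / (Zvs α n * (n : ℝ)))

/-- The set of allowed parameters `α ∈ {-1/d : d ∈ ℕ, d ≥ 2} ∪ [0, ∞)` for
very simple increasing trees. -/
def vsiAllowed : Set ℝ := {x : ℝ | ∃ d : ℕ, 2 ≤ d ∧ x = -1 / (d : ℝ)} ∪ Set.Ici (0 : ℝ)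

/-- A very simple increasing (v.s.i.) color-difference process with parameters `(α, q)` on the
measurable space `Ω`: a probability measure `μ`, a filtration `F`, and an adapted `ℤ²`-valued
process `Δ` with `Δ(1) = (1,0)`, whose increments `D(n) = Δ(n+1) - Δ(n)` are
`F(n+1)`-measurable with values in `{(1,1), (-1,1), (1,-1), (-1,-1)}`, and whose conditional
probabilities given `F n` (conditional expectations of indicator functions) are as prescribed. -/
structure VSIProcess (α q : ℝ) (Ω : Type) [mΩ : MeasurableSpace Ω] where
  μ : Measure Ω
  isProb : IsProbabilityMeasure μ
  F : ℕ → MeasurableSpace Ω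
  F_le : ∀ n, F n ≤ mΩ
  F_mono : Monotone F
  Δ : ℕ → Ω → ℤ × ℤ
  adapted : ∀ n, 1 ≤ n → @Measurable Ω (ℤ × ℤ) (F n) _ (Δ n)
  init : ∀ ω, Δ 1 ω = (1, 0)
  D_meas : ∀ n, 1 ≤ n → @Measurable Ω (ℤ × ℤ) (F (n + 1)) _ (fun ω => Δ (n + 1) ω - Δ n ω)
  D_range : ∀ n, 1 ≤ n → ∀ ω,
    Δ (n + 1) ω - Δ n ω ∈ ({(1, 1), (-1, 1), (1, -1), (-1, -1)} : Set (ℤ × ℤ))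
  cond_rr : ∀ n, 1 ≤ n →
    μ[Set.indicator {ω | Δ (n + 1) ω - Δ n ω = (1, 1)} (fun _ => (1 : ℝ)) | F n]
      =ᵐ[μ] fun ω => pvs α n (Δ n ω).1 (Δ n ω).2 * (1 - q)
  cond_br : ∀ n, 1 ≤ n →
    μ[Set.indicator {ω | Δ (n + 1) ω - Δ n ω = (-1, 1)} (fun _ => (1 : ℝ)) | F n]
      =ᵐ[μ] fun ω => pvs α n (Δ n ω).1 (Δ n ω).2 * q
  cond_rb : ∀ n, 1 ≤ n →
    μ[Set.indicator {ω | Δ (n + 1) ω - Δ n ω = (1, -1)} (fun _ => (1 : ℝ)) | F n]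
      =ᵐ[μ] fun ω => (1 - pvs α n (Δ n ω).1 (Δ n ω).2) * q
  cond_bb : ∀ n, 1 ≤ n →
    μ[Set.indicator {ω | Δ (n + 1) ω - Δ n ω = (-1, -1)} (fun _ => (1 : ℝ)) | F n]
      =ᵐ[μ] fun ω => (1 - pvs α n (Δ n ω).1 (Δ n ω).2) * (1 - q)

/-- `τ_high(A) = inf {n ≥ 1 : Δ₁(n) + α Δ₂(n) > A Z_α(n) √n}`, with value `∞` if no such `n`
exists. -/
noncomputable def tauHigh {α q : ℝ} {Ω : Type} [MeasurableSpace Ω]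
    (P : VSIProcess α q Ω) (A : ℝ) (ω : Ω) : ℕ∞ :=
  sInf {N : ℕ∞ | ∃ n : ℕ, N = (n : ℕ∞) ∧ 1 ≤ n ∧
    A * Zvs α n * Real.sqrt n < ((P.Δ n ω).1 : ℝ) + α * ((P.Δ n ω).2 : ℝ)}

/-- `τ_low(B) = inf {n > τ_high(A) : Δ₁(n) + α Δ₂(n) ≤ B Z_α(n) √n}`, with value `∞` if no such
`n` exists. -/
noncomputable def tauLow {α q : ℝ} {Ω : Type} [MeasurableSpace Ω]
    (P : VSIProcess α q Ω) (A B : ℝ) (ω : Ω) : ℕ∞ :=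
  sInf {N : ℕ∞ | ∃ n : ℕ, N = (n : ℕ∞) ∧ tauHigh P A ω < (n : ℕ∞) ∧
    ((P.Δ n ω).1 : ℝ) + α * ((P.Δ n ω).2 : ℝ) ≤ B * Zvs α n * Real.sqrt n}

section Helpers

variable {α q : ℝ} {Ω : Type} [MeasurableSpace Ω]

lemma vsi_bound (P : VSIProcess α q Ω) (n : ℕ) (ω : Ω) :
    P.Δ (n + 1) ω ∈ Set.Icc (-(n : ℤ) - 1, -(n : ℤ) - 1) ((n : ℤ) + 1, (n : ℤ) + 1) := by
  induction n with
  | zero => simp [P.init]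
  | succ k ih =>
    have h := P.D_range (k + 1) (by omega) ω
    obtain ⟨⟨a, b⟩, c, d⟩ := ih
    simp only [Set.mem_insert_iff, Set.mem_singleton_iff, Prod.ext_iff, Prod.fst_sub,
      Prod.snd_sub] at h
    push_cast
    refine ⟨⟨?_, ?_⟩, ?_, ?_⟩ <;> simp only at * <;> omega

lemma vsi_meas (P : VSIProcess α q Ω) (n : ℕ) (hn : 1 ≤ n) (G : ℤ × ℤ → ℝ) :
    StronglyMeasurable[P.F n] (fun ω => G (P.Δ n ω)) := by
  have h := P.adapted n hn
  have : Measurable[P.F n] (fun ω => G (P.Δ n ω)) := (measurable_of_countable G).comp h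
  exact this.stronglyMeasurable

lemma vsi_bdd (P : VSIProcess α q Ω) (n : ℕ) (hn : 1 ≤ n) (G : ℤ × ℤ → ℝ) :
    ∃ C : ℝ, ∀ ω, ‖G (P.Δ n ω)‖ ≤ C := by
  obtain ⟨k, rfl⟩ : ∃ k, n = k + 1 := ⟨n - 1, by omega⟩
  have hf : (Set.Icc ((-(k : ℤ) - 1, -(k : ℤ) - 1) : ℤ × ℤ) ((k : ℤ) + 1, (k : ℤ) + 1)).Finite :=
    Set.finite_Icc _ _
  obtain ⟨C, hC⟩ := (hf.image (fun x => ‖G x‖)).bddAbove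
  exact ⟨C, fun ω => hC ⟨_, vsi_bound P k ω, rfl⟩⟩

lemma vsi_int (P : VSIProcess α q Ω) (n : ℕ) (hn : 1 ≤ n) (G : ℤ × ℤ → ℝ) :
    Integrable (fun ω => G (P.Δ n ω)) P.μ := by
  have := P.isProb
  obtain ⟨C, hC⟩ := vsi_bdd P n hn G
  exact Integrable.of_bound ((vsi_meas P n hn G).mono (P.F_le n)).aestronglyMeasurable C
    (Eventually.of_forall hC)

lemma vsi_setmeas (P : VSIProcess α q Ω) (n : ℕ) (hn : 1 ≤ n) (d : ℤ × ℤ) :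
    MeasurableSet {ω | P.Δ (n + 1) ω - P.Δ n ω = d} := by
  have h : Measurable (fun ω => P.Δ (n + 1) ω - P.Δ n ω) := (P.D_meas n hn).mono (P.F_le _) le_rfl
  exact h (measurableSet_singleton d)

lemma vsi_part_int (P : VSIProcess α q Ω) (n : ℕ) (hn : 1 ≤ n) (d : ℤ × ℤ) (G : ℤ × ℤ → ℝ) :
    Integrable (fun ω => G (P.Δ n ω) *
      Set.indicator {ω | P.Δ (n + 1) ω - P.Δ n ω = d} (fun _ => (1 : ℝ)) ω) P.μ := by
  have h := (vsi_int P n hn G).indicator (vsi_setmeas P n hn d)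
  refine h.congr (Eventually.of_forall fun ω => ?_)
  by_cases hω : ω ∈ {ω | P.Δ (n + 1) ω - P.Δ n ω = d} <;> simp [Set.indicator, hω]

lemma vsi_part (P : VSIProcess α q Ω) (n : ℕ) (hn : 1 ≤ n) (d : ℤ × ℤ) (G : ℤ × ℤ → ℝ)
    (H : ℤ × ℤ → ℝ)
    (h : P.μ[Set.indicator {ω | P.Δ (n + 1) ω - P.Δ n ω = d} (fun _ => (1 : ℝ)) | P.F n]
      =ᵐ[P.μ] fun ω => H (P.Δ n ω)) :
    ∫ ω, G (P.Δ n ω) *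
      Set.indicator {ω | P.Δ (n + 1) ω - P.Δ n ω = d} (fun _ => (1 : ℝ)) ω ∂P.μ =
    ∫ ω, G (P.Δ n ω) * H (P.Δ n ω) ∂P.μ := by
  have := P.isProb
  rw [← integral_condExp (P.F_le n)]
  apply integral_congr_ae
  have h1 := condExp_mul_of_stronglyMeasurable_left (μ := P.μ) (m := P.F n)
    (f := fun ω => G (P.Δ n ω))
    (g := Set.indicator {ω | P.Δ (n + 1) ω - P.Δ n ω = d} (fun _ => (1 : ℝ)))
    (vsi_meas P n hn G) (vsi_part_int P n hn d G)
    ((integrable_const (1 : ℝ)).indicator (vsi_setmeas P n hn d))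
  refine h1.trans ?_
  filter_upwards [h] with ω hω
  simp [hω]

lemma integral_add4 (μ : Measure Ω) {f g h k : Ω → ℝ} (hf : Integrable f μ)
    (hg : Integrable g μ) (hh : Integrable h μ) (hk : Integrable k μ) :
    ∫ ω, (f ω + g ω + h ω + k ω) ∂μ =
      ∫ ω, f ω ∂μ + ∫ ω, g ω ∂μ + ∫ ω, h ω ∂μ + ∫ ω, k ω ∂μ := by
  have h1 : ∫ ω, (f ω + g ω + h ω) ∂μ = ∫ ω, (f ω + g ω) ∂μ + ∫ ω, h ω ∂μ :=
    integral_add (hf.add hg) hh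
  have h2 : ∫ ω, (f ω + g ω + h ω + k ω) ∂μ = ∫ ω, (f ω + g ω + h ω) ∂μ + ∫ ω, k ω ∂μ :=
    integral_add ((hf.add hg).add hh) hk
  rw [h2, h1, integral_add hf hg]

lemma vsi_step (P : VSIProcess α q Ω) (n : ℕ) (hn : 1 ≤ n) (G : ℤ × ℤ → ℝ) :
    ∫ ω, G (P.Δ (n + 1) ω) ∂P.μ = ∫ ω,
      (G (P.Δ n ω + (1, 1)) * (pvs α n (P.Δ n ω).1 (P.Δ n ω).2 * (1 - q)) +
       G (P.Δ n ω + (-1, 1)) * (pvs α n (P.Δ n ω).1 (P.Δ n ω).2 * q) +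
       G (P.Δ n ω + (1, -1)) * ((1 - pvs α n (P.Δ n ω).1 (P.Δ n ω).2) * q) +
       G (P.Δ n ω + (-1, -1)) * ((1 - pvs α n (P.Δ n ω).1 (P.Δ n ω).2) * (1 - q))) ∂P.μ := by
  have i1 := vsi_part_int P n hn (1, 1) (fun x => G (x + (1, 1)))
  have i2 := vsi_part_int P n hn (-1, 1) (fun x => G (x + (-1, 1)))
  have i3 := vsi_part_int P n hn (1, -1) (fun x => G (x + (1, -1)))
  have i4 := vsi_part_int P n hn (-1, -1) (fun x => G (x + (-1, -1)))
  have e1 := vsi_part P n hn (1, 1) (fun x => G (x + (1, 1)))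
    (fun x => pvs α n x.1 x.2 * (1 - q)) (P.cond_rr n hn)
  have e2 := vsi_part P n hn (-1, 1) (fun x => G (x + (-1, 1)))
    (fun x => pvs α n x.1 x.2 * q) (P.cond_br n hn)
  have e3 := vsi_part P n hn (1, -1) (fun x => G (x + (1, -1)))
    (fun x => (1 - pvs α n x.1 x.2) * q) (P.cond_rb n hn)
  have e4 := vsi_part P n hn (-1, -1) (fun x => G (x + (-1, -1)))
    (fun x => (1 - pvs α n x.1 x.2) * (1 - q)) (P.cond_bb n hn)
  have j1 := vsi_int P n hn (fun x => G (x + (1, 1)) * (pvs α n x.1 x.2 * (1 - q)))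
  have j2 := vsi_int P n hn (fun x => G (x + (-1, 1)) * (pvs α n x.1 x.2 * q))
  have j3 := vsi_int P n hn (fun x => G (x + (1, -1)) * ((1 - pvs α n x.1 x.2) * q))
  have j4 := vsi_int P n hn (fun x => G (x + (-1, -1)) * ((1 - pvs α n x.1 x.2) * (1 - q)))
  rw [integral_add4 P.μ j1 j2 j3 j4, ← e1, ← e2, ← e3, ← e4, ← integral_add4 P.μ i1 i2 i3 i4]
  apply integral_congr_ae
  refine Eventually.of_forall fun ω => ?_
  have h := P.D_range n hn ω
  simp only [Set.mem_insert_iff, Set.mem_singleton_iff] at h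
  have hs : P.Δ (n + 1) ω = P.Δ n ω + (P.Δ (n + 1) ω - P.Δ n ω) := by abel
  simp only [Set.indicator, Set.mem_ofPred_eq]
  rcases h with h | h | h | h <;> rw [h] at hs <;> simp [h, hs]

/-- The weighted difference. -/
def vS (α : ℝ) (x : ℤ × ℤ) : ℝ := (x.1 : ℝ) + α * (x.2 : ℝ)

/-- The total weight. -/
def vw (α : ℝ) (n : ℕ) : ℝ := (1 + α) * (n : ℝ) - α

lemma pvs_eq (n : ℕ) (hn : 1 ≤ n) (x : ℤ × ℤ) :
    pvs α n x.1 x.2 = (1 / 2) * (1 + vS α x / vw α n) := by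
  have : (n : ℝ) ≠ 0 := by positivity
  have h : Zvs α n * (n : ℝ) = vw α n := by
    unfold Zvs vw; field_simp; ring
  rw [pvs, h, vS]

lemma vsi_mean (P : VSIProcess α q Ω) (n : ℕ) (hn : 1 ≤ n) :
    ∫ ω, vS α (P.Δ (n + 1) ω) ∂P.μ =
      (∫ ω, vS α (P.Δ n ω) ∂P.μ) * (1 + (1 + α - 2 * q) / vw α n) := by
  rw [vsi_step P n hn, ← integral_mul_const]
  congr 1; ext ω
  rw [pvs_eq n hn]
  simp only [vS, Prod.fst_add, Prod.snd_add]
  push_cast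
  ring

lemma vsi_sq (P : VSIProcess α q Ω) (n : ℕ) (hn : 1 ≤ n) :
    ∫ ω, vS α (P.Δ (n + 1) ω) ^ 2 ∂P.μ =
      (∫ ω, vS α (P.Δ n ω) ^ 2 ∂P.μ) * (1 + 2 * (1 + α - 2 * q) / vw α n)
        + ((1 + α) ^ 2 - 4 * α * q) := by
  have := P.isProb
  have h0 : ∫ ω, ((1 + α) ^ 2 - 4 * α * q) ∂P.μ = (1 + α) ^ 2 - 4 * α * q := by simp
  rw [vsi_step P n hn (fun x => vS α x ^ 2), ← integral_mul_const]
  conv_rhs => arg 2; rw [← h0]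
  rw [← integral_add ((vsi_int P n hn (fun x => vS α x ^ 2)).mul_const _) (integrable_const _)]
  congr 1; ext ω
  rw [pvs_eq n hn]
  simp only [vS, Prod.fst_add, Prod.snd_add]
  push_cast
  ring

lemma vsi_Y (P : VSIProcess α q Ω) (κ : ℝ) (hκ : κ * (1 + α - 2 * q) = 1 - 2 * q)
    (n : ℕ) (hn : 1 ≤ n) :
    ∫ ω, (((P.Δ (n + 1) ω).1 : ℝ) - κ * vS α (P.Δ (n + 1) ω)) ^ 2 ∂P.μ =
      (∫ ω, (((P.Δ n ω).1 : ℝ) - κ * vS α (P.Δ n ω)) ^ 2 ∂P.μ)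
        + ((1 - κ) ^ 2 + κ ^ 2 * α ^ 2 - 2 * (1 - κ) * κ * α * (1 - 2 * q)) := by
  have := P.isProb
  set L := (1 - κ) ^ 2 + κ ^ 2 * α ^ 2 - 2 * (1 - κ) * κ * α * (1 - 2 * q) with hL
  have h0 : ∫ ω, L ∂P.μ = L := by simp
  rw [vsi_step P n hn (fun x => ((x.1 : ℝ) - κ * vS α x) ^ 2)]
  conv_rhs => arg 2; rw [← h0]
  rw [← integral_add (vsi_int P n hn (fun x => ((x.1 : ℝ) - κ * vS α x) ^ 2))
    (integrable_const _)]
  congr 1; ext ω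
  rw [pvs_eq n hn]
  simp only [vS, Prod.fst_add, Prod.snd_add]
  push_cast
  rw [hL]
  set a : ℝ := ((P.Δ n ω).1 : ℝ)
  set b : ℝ := ((P.Δ n ω).2 : ℝ)
  set t : ℝ := (a + α * b) / vw α n
  linear_combination (-2 * (a - κ * (a + α * b)) * t) * hκ

end Helpers

/-- Lower bound on the normalised mean. -/
lemma scal_u (q : ℝ) (hq : 0 ≤ q) (hq0 : q ≤ 1 / 32) (u w : ℕ → ℝ)
    (hw : ∀ n : ℕ, 1 ≤ n → (n : ℝ) / 2 ≤ w n) (hu1 : u 1 = 1)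
    (hu : ∀ n : ℕ, 1 ≤ n → u (n + 1) = u n * (1 - 2 * q / w (n + 1))) (n : ℕ) (hn : 1 ≤ n) :
    0 < u n ∧ u n ≤ 1 ∧ 1 / (n : ℝ) ≤ u n ^ 8 ∧ 1 - u n ≤ 8 * q * √(n : ℝ) := by
  induction n, hn using Nat.le_induction with
  | base => rw [hu1]; norm_num; exact hq
  | succ n hn ih =>
    obtain ⟨h0, h1, h8, hs⟩ := ih
    have hn' : (1 : ℝ) ≤ n := by exact_mod_cast hn
    have hwn := hw (n + 1) (by omega)
    push_cast at hwn
    have hwpos : 0 < w (n + 1) := by linarith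
    have hx0 : 0 ≤ 2 * q / w (n + 1) := by positivity
    have hx1 : 2 * q / w (n + 1) ≤ 4 * q / ((n : ℝ) + 1) := by
      rw [div_le_div_iff₀ hwpos (by linarith)]
      nlinarith
    have hx2 : 4 * q / ((n : ℝ) + 1) ≤ 1 / (8 * ((n : ℝ) + 1)) := by
      rw [div_le_div_iff₀ (by linarith) (by linarith)]
      nlinarith
    have hx3 : 1 / (8 * ((n : ℝ) + 1)) ≤ 1 / 8 := by
      apply one_div_le_one_div_of_le <;> linarith
    rw [hu n hn]
    set x := 2 * q / w (n + 1)
    refine ⟨by apply mul_pos h0; linarith, by nlinarith, ?_, ?_⟩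
    · have hb := one_add_mul_le_pow (a := -x) (by linarith) 8
      push_cast at hb
      have hb2 : (n : ℝ) / (n + 1) ≤ (1 - x) ^ 8 := by
        have : (n : ℝ) / (n + 1) = 1 - 8 * (1 / (8 * ((n : ℝ) + 1))) := by field_simp; ring
        rw [this]
        have e : (1 + -x) = 1 - x := by ring
        rw [e] at hb
        linarith
      rw [mul_pow]
      calc 1 / ((n + 1 : ℕ) : ℝ) = 1 / (n : ℝ) * ((n : ℝ) / (n + 1)) := by
            push_cast; field_simp
        _ ≤ _ := mul_le_mul h8 hb2 (by positivity) (by positivity)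
    · push_cast
      have hsq : 1 / (2 * ((n : ℝ) + 1)) ≤ √((n : ℝ) + 1) - √(n : ℝ) := by
        have a1 := Real.sq_sqrt (show (0 : ℝ) ≤ (n : ℝ) + 1 by linarith)
        have a2 := Real.sq_sqrt (show (0 : ℝ) ≤ (n : ℝ) by linarith)
        have a3 : 1 ≤ √((n : ℝ) + 1) := Real.one_le_sqrt.2 (by linarith)
        have a4 : 0 ≤ √(n : ℝ) := Real.sqrt_nonneg _
        have a5 : √(n : ℝ) ≤ √((n : ℝ) + 1) := Real.sqrt_le_sqrt (by linarith)
        rw [div_le_iff₀ (by linarith)]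
        set s := √((n : ℝ) + 1)
        set r := √(n : ℝ)
        have : (s - r) * (s + r) = 1 := by linarith [mul_comm s r, sq s, sq r, sub_nonneg.2 a5,
          show (s - r) * (s + r) = s ^ 2 - r ^ 2 by ring]
        have h2 : s + r ≤ 2 * ((n : ℝ) + 1) := by nlinarith
        nlinarith [mul_le_mul_of_nonneg_left h2 (sub_nonneg.2 a5)]
      have : 4 * q / ((n : ℝ) + 1) = 8 * q * (1 / (2 * ((n : ℝ) + 1))) := by field_simp; ring
      have h9 := mul_le_mul_of_nonneg_left hsq (show 0 ≤ 8 * q by linarith)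
      nlinarith

lemma scal_m (q : ℝ) (hq : 0 ≤ q) (hq0 : q ≤ 1 / 32) (u w : ℕ → ℝ)
    (hw : ∀ n : ℕ, 1 ≤ n → (n : ℝ) / 2 ≤ w n) (hu1 : u 1 = 1)
    (hu : ∀ n : ℕ, 1 ≤ n → u (n + 1) = u n * (1 - 2 * q / w (n + 1))) (n : ℕ) (hn : 1 ≤ n) :
    (n : ℝ) ^ (7 / 4 : ℝ) / 4 ≤ (w n * u n) ^ 2 := by
  obtain ⟨h0, h1, h8, -⟩ := scal_u q hq hq0 u w hw hu1 hu n hn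
  have hn' : (1 : ℝ) ≤ n := by exact_mod_cast hn
  have hnp : (0 : ℝ) < n := by linarith
  have h2 : (n : ℝ) ^ (-(1 / 4) : ℝ) ≤ u n ^ 2 := by
    have : (1 / (n : ℝ)) ^ (1 / 4 : ℝ) ≤ (u n ^ 8) ^ (1 / 4 : ℝ) :=
      Real.rpow_le_rpow (by positivity) h8 (by norm_num)
    have e1 : (1 / (n : ℝ)) ^ (1 / 4 : ℝ) = (n : ℝ) ^ (-(1 / 4) : ℝ) := by
      rw [one_div, Real.inv_rpow hnp.le, Real.rpow_neg hnp.le]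
    have e2 : (u n ^ 8) ^ (1 / 4 : ℝ) = u n ^ 2 := by
      rw [← Real.rpow_natCast, ← Real.rpow_natCast, ← Real.rpow_mul h0.le]
      norm_num
    rwa [e1, e2] at this
  have h3 : (n : ℝ) ^ 2 / 4 ≤ w n ^ 2 := by
    have := hw n hn
    nlinarith
  have e : (n : ℝ) ^ (7 / 4 : ℝ) = (n : ℝ) ^ 2 * (n : ℝ) ^ (-(1 / 4) : ℝ) := by
    rw [← Real.rpow_natCast, ← Real.rpow_add hnp]; norm_num
  rw [mul_pow, e, mul_div_right_comm]
  exact mul_le_mul h3 h2 (by positivity) (by positivity)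

set_option maxHeartbeats 1000000 in
/-- Bound on the relative variance. -/
lemma scal_r (α q : ℝ) (hα : -(1 / 2) ≤ α) (hq : 0 ≤ q) (hq0 : q ≤ 1 / 32) (u w m v : ℕ → ℝ)
    (hw : ∀ n : ℕ, 1 ≤ n → (n : ℝ) / 2 ≤ w n) (hu1 : u 1 = 1)
    (hu : ∀ n : ℕ, 1 ≤ n → u (n + 1) = u n * (1 - 2 * q / w (n + 1)))
    (hmu : ∀ n : ℕ, 1 ≤ n → m n = w n * u n)
    (hm : ∀ n : ℕ, 1 ≤ n → m (n + 1) = m n * (1 + (1 + α - 2 * q) / w n))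
    (hv1 : v 1 - m 1 ^ 2 = 0) (hV : ∀ n, 1 ≤ n → 0 ≤ v n - m n ^ 2)
    (hv : ∀ n : ℕ, 1 ≤ n → v (n + 1) = v n * (1 + 2 * (1 + α - 2 * q) / w n)
      + ((1 + α) ^ 2 - 4 * α * q)) (n : ℕ) (hn : 1 ≤ n) :
    (v n - m n ^ 2) / m n ^ 2 ≤ q * (4 * (16 * (1 + α) ^ 2 + 4 * (1 + α) + 4 * |α|)) *
      ∑ k ∈ Finset.range (n + 1), (k : ℝ) ^ (-(5 / 4) : ℝ) := by
  induction n, hn using Nat.le_induction with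
  | base =>
    rw [hv1, zero_div]
    have : 0 ≤ 1 + α := by linarith
    apply mul_nonneg (by positivity)
    exact Finset.sum_nonneg fun i _ => by positivity
  | succ n hn ih =>
    obtain ⟨h0, h1, -, hs⟩ := scal_u q hq hq0 u w hw hu1 hu n hn
    have hM := scal_m q hq hq0 u w hw hu1 hu (n + 1) (by omega)
    rw [← hmu (n + 1) (by omega)] at hM
    have hn' : (1 : ℝ) ≤ n := by exact_mod_cast hn
    have hwn : 0 < w n := by linarith [hw n hn]
    have hmn : 0 < m n := by rw [hmu n hn]; positivity
    have hpos : 0 < ((n + 1 : ℕ) : ℝ) ^ (7 / 4 : ℝ) / 4 := by positivity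
    have hM0 : 0 < m (n + 1) ^ 2 := by linarith
    set b := 1 + α - 2 * q with hb
    have hbpos : 0 < b := by linarith
    rw [Finset.sum_range_succ, mul_add]
    set C := 16 * (1 + α) ^ 2 + 4 * (1 + α) + 4 * |α| with hC
    have hC0 : 0 ≤ C := by have : 0 ≤ 1 + α := by linarith
                           positivity
    have key : v (n + 1) - m (n + 1) ^ 2 = (v n - m n ^ 2) * (1 + 2 * b / w n) +
        ((1 + α) ^ 2 - 4 * α * q - u n ^ 2 * b ^ 2) := by
      rw [hv n hn, hm n hn, hmu n hn]
      field_simp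
      ring
    have s1 : 1 ≤ √(n : ℝ) := Real.one_le_sqrt.2 hn'
    have hg : (1 + α) ^ 2 - 4 * α * q - u n ^ 2 * b ^ 2 ≤ q * C * √(n : ℝ) := by
      have g1 : (1 + α) ^ 2 - 4 * α * q - u n ^ 2 * b ^ 2 ≤
          (1 + α) ^ 2 * (2 * (1 - u n)) + 4 * (1 + α) * q + 4 * |α| * q := by
        have f1 : -(α * q) ≤ |α| * q := by
          have := neg_abs_le α
          nlinarith
        have f2 : u n ^ 2 ≤ 1 := by nlinarith
        have f3 : 1 - u n ^ 2 ≤ 2 * (1 - u n) := by nlinarith [sq_nonneg (1 - u n)]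
        have f4 : (1 + α) ^ 2 * (1 - u n ^ 2) ≤ (1 + α) ^ 2 * (2 * (1 - u n)) :=
          mul_le_mul_of_nonneg_left f3 (sq_nonneg _)
        have f5 : u n ^ 2 * ((1 + α) * q) ≤ 1 * ((1 + α) * q) :=
          mul_le_mul_of_nonneg_right f2 (mul_nonneg (by linarith) hq)
        have f6 : 0 ≤ u n ^ 2 * q ^ 2 := by positivity
        rw [hb]
        nlinarith
      have g2 : (1 + α) ^ 2 * (2 * (1 - u n)) ≤ (1 + α) ^ 2 * (2 * (8 * q * √(n : ℝ))) :=
        mul_le_mul_of_nonneg_left (by linarith) (sq_nonneg _)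
      have g3 : (4 * (1 + α) * q + 4 * |α| * q) * 1 ≤
          (4 * (1 + α) * q + 4 * |α| * q) * √(n : ℝ) := by
        apply mul_le_mul_of_nonneg_left s1
        have : 0 ≤ 1 + α := by linarith
        positivity
      rw [hC]
      linarith
    rw [key, add_div]
    apply add_le_add
    · refine le_trans ?_ ih
      rw [div_le_div_iff₀ hM0 (by positivity), mul_assoc]
      apply mul_le_mul_of_nonneg_left _ (hV n hn)
      rw [hm n hn, mul_pow, mul_comm]
      apply mul_le_mul_of_nonneg_left _ (by positivity)
      have : 0 ≤ (b / w n) ^ 2 := by positivity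
      have e : 2 * b / w n = 2 * (b / w n) := by ring
      rw [e]
      nlinarith
    · rw [div_le_iff₀ hM0]
      have np : (0 : ℝ) < ((n + 1 : ℕ) : ℝ) := by positivity
      have e : √((n + 1 : ℕ) : ℝ) = 4 * (((n + 1 : ℕ) : ℝ) ^ (-(5 / 4) : ℝ) *
          (((n + 1 : ℕ) : ℝ) ^ (7 / 4 : ℝ) / 4)) := by
        rw [Real.sqrt_eq_rpow, mul_div_assoc', ← Real.rpow_add np]
        norm_num
        ring
      have l1 : √(n : ℝ) ≤ √((n + 1 : ℕ) : ℝ) := Real.sqrt_le_sqrt (by push_cast; linarith)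
      have l2 : ((n + 1 : ℕ) : ℝ) ^ (-(5 / 4) : ℝ) * (((n + 1 : ℕ) : ℝ) ^ (7 / 4 : ℝ) / 4) ≤
          ((n + 1 : ℕ) : ℝ) ^ (-(5 / 4) : ℝ) * m (n + 1) ^ 2 :=
        mul_le_mul_of_nonneg_left hM (by positivity)
      calc _ ≤ q * C * √(n : ℝ) := hg
        _ ≤ q * C * (4 * (((n + 1 : ℕ) : ℝ) ^ (-(5 / 4) : ℝ) * m (n + 1) ^ 2)) := by
            apply mul_le_mul_of_nonneg_left _ (by positivity)
            linarith
        _ = _ := by ring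

lemma vsi_small (α q : ℝ) (hα : -(1 / 2) ≤ α) (hq : 0 ≤ q) (hq0 : q ≤ 1 / 32)
    (Ω : Type) [MeasurableSpace Ω] (P : VSIProcess α q Ω) :
    Filter.limsup (fun N : ℕ =>
              (P.μ {ω | (P.Δ N ω).1 < 0}).toReal +
                (1 / 2) * (P.μ {ω | (P.Δ N ω).1 = 0}).toReal)
            Filter.atTop ≤ 4 * (q * (4 * (16 * (1 + α) ^ 2 + 4 * (1 + α) + 4 * |α|)) *
      ∑' k : ℕ, (k : ℝ) ^ (-(5 / 4) : ℝ)) := by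
  have := P.isProb
  set w : ℕ → ℝ := vw α with hwdef
  set m : ℕ → ℝ := fun n => ∫ ω, vS α (P.Δ n ω) ∂P.μ with hmdef
  set v : ℕ → ℝ := fun n => ∫ ω, vS α (P.Δ n ω) ^ 2 ∂P.μ with hvdef
  set u : ℕ → ℝ := fun n => m n / w n with hudef
  have hw : ∀ n : ℕ, 1 ≤ n → (n : ℝ) / 2 ≤ w n := by
    intro n hn
    have hn' : (1 : ℝ) ≤ n := by exact_mod_cast hn
    simp only [hwdef, vw]
    nlinarith
  have hw0 : ∀ n : ℕ, 1 ≤ n → 0 < w n := by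
    intro n hn
    have hn' : (1 : ℝ) ≤ n := by exact_mod_cast hn
    linarith [hw n hn]
  have hw1 : w 1 = 1 := by simp [hwdef, vw]
  have hm1 : m 1 = 1 := by simp [hmdef, vS, P.init]
  have hv1 : v 1 = 1 := by simp [hvdef, vS, P.init]
  have hu1 : u 1 = 1 := by simp [hudef, hm1, hw1]
  have hmu : ∀ n : ℕ, 1 ≤ n → m n = w n * u n := by
    intro n hn
    have := (hw0 n hn).ne'
    simp only [hudef]; field_simp
  have hm : ∀ n : ℕ, 1 ≤ n → m (n + 1) = m n * (1 + (1 + α - 2 * q) / w n) :=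
    fun n hn => vsi_mean P n hn
  have hv : ∀ n : ℕ, 1 ≤ n → v (n + 1) = v n * (1 + 2 * (1 + α - 2 * q) / w n)
      + ((1 + α) ^ 2 - 4 * α * q) := fun n hn => vsi_sq P n hn
  have hu : ∀ n : ℕ, 1 ≤ n → u (n + 1) = u n * (1 - 2 * q / w (n + 1)) := by
    intro n hn
    have a1 := (hw0 n hn).ne'
    have a2 := (hw0 (n + 1) (by omega)).ne'
    have a3 : w (n + 1) = w n + (1 + α) := by simp only [hwdef, vw]; push_cast; ring
    simp only [hudef]
    rw [hm n hn]
    field_simp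
    rw [a3]; ring
  have hVint : ∀ n, 1 ≤ n → ∫ ω, (vS α (P.Δ n ω) - m n) ^ 2 ∂P.μ = v n - m n ^ 2 := by
    intro n hn
    have i1 := vsi_int P n hn (fun x => vS α x ^ 2)
    have i2 := (vsi_int P n hn (fun x => vS α x)).mul_const (2 * m n)
    have : ∀ ω, (vS α (P.Δ n ω) - m n) ^ 2 =
        vS α (P.Δ n ω) ^ 2 - vS α (P.Δ n ω) * (2 * m n) + m n ^ 2 := fun ω => by ring
    simp_rw [this]
    rw [show ∫ ω, (vS α (P.Δ n ω) ^ 2 - vS α (P.Δ n ω) * (2 * m n) + m n ^ 2) ∂P.μ =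
      ∫ ω, (vS α (P.Δ n ω) ^ 2 - vS α (P.Δ n ω) * (2 * m n)) ∂P.μ + ∫ ω, m n ^ 2 ∂P.μ from
      integral_add (i1.sub i2) (integrable_const _), integral_sub i1 i2, integral_mul_const]
    simp only [integral_const, probReal_univ, one_smul]
    simp only [hvdef, hmdef]
    ring
  have hV : ∀ n, 1 ≤ n → 0 ≤ v n - m n ^ 2 := by
    intro n hn
    rw [← hVint n hn]
    exact integral_nonneg fun ω => sq_nonneg _
  have hr := scal_r α q hα hq hq0 u w m v hw hu1 hu hmu hm (by rw [hv1, hm1]; norm_num) hV hv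
  have hM : ∀ n : ℕ, 1 ≤ n → (n : ℝ) ^ (7 / 4 : ℝ) / 4 ≤ m n ^ 2 := by
    intro n hn
    rw [hmu n hn]
    exact scal_m q hq hq0 u w hw hu1 hu n hn
  have hm0 : ∀ n, 1 ≤ n → 0 < m n := by
    intro n hn
    rw [hmu n hn]
    exact mul_pos (hw0 n hn) (scal_u q hq hq0 u w hw hu1 hu n hn).1
  set κ := (1 - 2 * q) / (1 + α - 2 * q) with hκdef
  have hb : 0 < 1 + α - 2 * q := by linarith
  have hκ : κ * (1 + α - 2 * q) = 1 - 2 * q := by rw [hκdef]; field_simp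
  have hκ0 : 0 < κ := div_pos (by linarith) hb
  set L := (1 - κ) ^ 2 + κ ^ 2 * α ^ 2 - 2 * (1 - κ) * κ * α * (1 - 2 * q) with hL
  have hY : ∀ n : ℕ, 1 ≤ n → ∫ ω, (((P.Δ n ω).1 : ℝ) - κ * vS α (P.Δ n ω)) ^ 2 ∂P.μ =
      (1 - κ) ^ 2 + L * ((n : ℝ) - 1) := by
    intro n hn
    induction n, hn using Nat.le_induction with
    | base => simp [vS, P.init]
    | succ n hn ih =>
      rw [vsi_Y P κ hκ n hn, ih]
      push_cast; ring
  set B := (1 - κ) ^ 2 + |L| with hB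
  have hB0 : 0 ≤ B := by positivity
  have hY2 : ∀ n : ℕ, 1 ≤ n → ∫ ω, (((P.Δ n ω).1 : ℝ) - κ * vS α (P.Δ n ω)) ^ 2 ∂P.μ ≤
      B * n := by
    intro n hn
    have hn' : (1 : ℝ) ≤ n := by exact_mod_cast hn
    rw [hY n hn, hB]
    have := le_abs_self L
    nlinarith [sq_nonneg (1 - κ), abs_nonneg L]
  set T := ∑' k : ℕ, (k : ℝ) ^ (-(5 / 4) : ℝ) with hT
  set C := 4 * (16 * (1 + α) ^ 2 + 4 * (1 + α) + 4 * |α|) with hC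
  have hC0 : 0 ≤ C := by have : 0 ≤ 1 + α := by linarith
                         positivity
  have hsum : Summable (fun k : ℕ => (k : ℝ) ^ (-(5 / 4) : ℝ)) :=
    Real.summable_nat_rpow.2 (by norm_num)
  have hmain : ∀ n : ℕ, 1 ≤ n →
      (P.μ {ω | (P.Δ n ω).1 < 0}).toReal + (1 / 2) * (P.μ {ω | (P.Δ n ω).1 = 0}).toReal ≤
      4 * (q * C * T) + 16 * B / κ ^ 2 * (n : ℝ) ^ (-(3 / 4) : ℝ) := by
    intro n hn
    have np : (0 : ℝ) < n := by exact_mod_cast hn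
    have a1 : P.μ.real {ω | (P.Δ n ω).1 < 0} ≤ P.μ.real {ω | (P.Δ n ω).1 ≤ 0} :=
      measureReal_mono (fun ω (h : (P.Δ n ω).1 < 0) => h.le)
    have a2 : P.μ.real {ω | (P.Δ n ω).1 = 0} ≤ P.μ.real {ω | (P.Δ n ω).1 ≤ 0} :=
      measureReal_mono (fun ω (h : (P.Δ n ω).1 = 0) => h.le)
    have a0 : 0 ≤ P.μ.real {ω | (P.Δ n ω).1 = 0} := measureReal_nonneg
    change P.μ.real _ + (1 / 2) * P.μ.real _ ≤ _
    set G : ℤ × ℤ → ℝ := fun x => (vS α x - m n) ^ 2 + ((x.1 : ℝ) - κ * vS α x) ^ 2 / κ ^ 2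
    have hG := vsi_int P n hn G
    have hmk := mul_meas_ge_le_integral_of_nonneg (μ := P.μ) (f := fun ω => G (P.Δ n ω))
      (Eventually.of_forall fun ω => by simp only [G, Pi.zero_apply]; positivity) hG (m n ^ 2 / 2)
    have hsub : P.μ.real {ω | (P.Δ n ω).1 ≤ 0} ≤ P.μ.real {ω | m n ^ 2 / 2 ≤ G (P.Δ n ω)} := by
      refine measureReal_mono ?_ (measure_ne_top _ _)
      intro ω hω
      have hω' : ((P.Δ n ω).1 : ℝ) ≤ 0 := by exact_mod_cast hω
      simp only [Set.mem_ofPred_eq, G]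
      set s := vS α (P.Δ n ω)
      rw [← div_pow]
      set y := (((P.Δ n ω).1 : ℝ) - κ * s) / κ with hy
      have hys : y + s ≤ 0 := by
        have : y + s = ((P.Δ n ω).1 : ℝ) / κ := by rw [hy]; field_simp; ring
        rw [this]
        exact div_nonpos_of_nonpos_of_nonneg hω' hκ0.le
      have := hm0 n hn
      nlinarith [sq_nonneg (s - m n - y)]
    have hI : ∫ ω, G (P.Δ n ω) ∂P.μ ≤ (v n - m n ^ 2) + B * n / κ ^ 2 := by
      have e : ∫ ω, G (P.Δ n ω) ∂P.μ = (v n - m n ^ 2) +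
          (∫ ω, (((P.Δ n ω).1 : ℝ) - κ * vS α (P.Δ n ω)) ^ 2 ∂P.μ) / κ ^ 2 := by
        rw [← hVint n hn, ← integral_div]
        exact integral_add (vsi_int P n hn (fun x => (vS α x - m n) ^ 2))
          (vsi_int P n hn (fun x => ((x.1 : ℝ) - κ * vS α x) ^ 2 / κ ^ 2))
      rw [e]
      have := hY2 n hn
      gcongr
    have hm2 : 0 < m n ^ 2 := by have := hm0 n hn; positivity
    have hrn : (v n - m n ^ 2) ≤ (q * C * T) * m n ^ 2 := by
      rw [← div_le_iff₀ hm2]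
      refine (hr n hn).trans ?_
      apply mul_le_mul_of_nonneg_left _ (by positivity)
      exact hsum.sum_le_tsum _ (fun i _ => by positivity)
    have hn2 : (n : ℝ) ≤ 4 * (n : ℝ) ^ (-(3 / 4) : ℝ) * m n ^ 2 := by
      have e : (n : ℝ) = 4 * (n : ℝ) ^ (-(3 / 4) : ℝ) * ((n : ℝ) ^ (7 / 4 : ℝ) / 4) := by
        have : (n : ℝ) ^ (-(3 / 4) : ℝ) * (n : ℝ) ^ (7 / 4 : ℝ) = n := by
          rw [← Real.rpow_add np]; norm_num
        linarith
      calc (n : ℝ) = _ := e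
        _ ≤ _ := mul_le_mul_of_nonneg_left (hM n hn) (by positivity)
    have hB2 : B * n / κ ^ 2 ≤ B / κ ^ 2 * (4 * (n : ℝ) ^ (-(3 / 4) : ℝ) * m n ^ 2) := by
      rw [mul_div_right_comm]
      exact mul_le_mul_of_nonneg_left hn2 (by positivity)
    have hfin : P.μ.real {ω | m n ^ 2 / 2 ≤ G (P.Δ n ω)} ≤
        2 * (q * C * T) + 8 * B / κ ^ 2 * (n : ℝ) ^ (-(3 / 4) : ℝ) := by
      have : m n ^ 2 / 2 * P.μ.real {ω | m n ^ 2 / 2 ≤ G (P.Δ n ω)} ≤ m n ^ 2 / 2 *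
          (2 * (q * C * T) + 8 * B / κ ^ 2 * (n : ℝ) ^ (-(3 / 4) : ℝ)) := by
        refine hmk.trans (hI.trans ?_)
        calc _ ≤ _ := add_le_add hrn hB2
          _ = _ := by ring
      exact le_of_mul_le_mul_left this (by positivity)
    have e2 : 16 * B / κ ^ 2 * (n : ℝ) ^ (-(3 / 4) : ℝ) =
      2 * (8 * B / κ ^ 2 * (n : ℝ) ^ (-(3 / 4) : ℝ)) := by ring
    rw [e2]
    linarith
  have hlim : Tendsto (fun n : ℕ => 4 * (q * C * T) + 16 * B / κ ^ 2 * (n : ℝ) ^ (-(3 / 4) : ℝ))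
      atTop (nhds (4 * (q * C * T))) := by
    have h1 : Tendsto (fun n : ℕ => (n : ℝ) ^ (-(3 / 4) : ℝ)) atTop (nhds 0) :=
      (tendsto_rpow_neg_atTop (by norm_num)).comp tendsto_natCast_atTop_atTop
    simpa using (h1.const_mul (16 * B / κ ^ 2)).const_add (4 * (q * C * T))
  rw [← hlim.limsup_eq]
  apply limsup_le_limsup
  · filter_upwards [eventually_ge_atTop 1] with n hn using hmain n hn
  · exact isCoboundedUnder_le_of_le (x := 0) atTop (fun n => by positivity)
  · exact hlim.isBoundedUnder_le

/-- For every allowed `α` there is `c_α > 0` such that, for every `q ∈ [0,1]` and every very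
simple increasing color-difference process with parameters `(α, q)`, the limsup of the error
probability `μ(Δ₁(N) < 0) + (1/2)μ(Δ₁(N) = 0)` of the majority estimator is at most
`c_α √q`. -/
theorem vsi_majority_bound (α : ℝ) (hα : α ∈ vsiAllowed) :
    ∃ c : ℝ, 0 < c ∧
      ∀ q : ℝ, 0 ≤ q → q ≤ 1 →
        ∀ (Ω : Type) [MeasurableSpace Ω] (P : VSIProcess α q Ω),
          Filter.limsup (fun N : ℕ =>
              (P.μ {ω | (P.Δ N ω).1 < 0}).toReal +
                (1 / 2) * (P.μ {ω | (P.Δ N ω).1 = 0}).toReal)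
            Filter.atTop ≤ c * Real.sqrt q := by
  have hα' : -(1 / 2) ≤ α := by
    rcases hα with ⟨d, hd, rfl⟩ | h
    · have : (2 : ℝ) ≤ d := by exact_mod_cast hd
      rw [neg_div]
      exact neg_le_neg (one_div_le_one_div_of_le (by norm_num) this)
    · have : 0 ≤ α := h
      linarith
  set K := 4 * ((4 * (16 * (1 + α) ^ 2 + 4 * (1 + α) + 4 * |α|)) *
      ∑' k : ℕ, (k : ℝ) ^ (-(5 / 4) : ℝ)) with hK
  have hK0 : 0 ≤ K := by
    have h1 : 0 ≤ 1 + α := by linarith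
    have h2 : 0 ≤ ∑' k : ℕ, (k : ℝ) ^ (-(5 / 4) : ℝ) := tsum_nonneg fun i => by positivity
    positivity
  refine ⟨K + 12, by linarith, ?_⟩
  intro q hq hq1 Ω _ P
  have := P.isProb
  have hs0 := Real.sqrt_nonneg q
  have hss := Real.sq_sqrt hq
  by_cases hq0 : q ≤ 1 / 32
  · have h := vsi_small α q hα' hq hq0 Ω P
    have hs1 : √q ≤ 1 := Real.sqrt_le_one.2 hq1
    have hqs : q ≤ √q := by nlinarith
    refine h.trans ?_
    calc _ = K * q := by rw [hK]; ring
      _ ≤ K * √q := mul_le_mul_of_nonneg_left hqs hK0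
      _ ≤ _ := by nlinarith
  · have hq2 : 1 / 8 ≤ √q := by
      apply Real.le_sqrt_of_sq_le
      push Not at hq0
      norm_num
      linarith
    have h : Filter.limsup (fun N : ℕ =>
              (P.μ {ω | (P.Δ N ω).1 < 0}).toReal +
                (1 / 2) * (P.μ {ω | (P.Δ N ω).1 = 0}).toReal)
            Filter.atTop ≤ 3 / 2 := by
      apply limsup_le_of_le
      · exact isCoboundedUnder_le_of_le (x := 0) atTop (fun n => by positivity)
      · refine Eventually.of_forall fun n => ?_
        have a1 : P.μ.real {ω | (P.Δ n ω).1 < 0} ≤ 1 := measureReal_le_one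
        have a2 : P.μ.real {ω | (P.Δ n ω).1 = 0} ≤ 1 := measureReal_le_one
        change P.μ.real _ + (1 / 2) * P.μ.real _ ≤ _
        linarith
    nlinarith
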